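/- Let S be the ℕ×ℕ matrix of Stirling numbers of the second kind, S_{ij} = S(j,i), let L = log(S) = ∑_{n≥1} (-1)^{n+1}(S-1)^n/n, and define c_n := L_{1n} for n ≥ 1. Then c_{n+1} = ∑_{k=1}^{n} c_{k+1} · S(n+1, k) for every n ≥ 1 (equivalently ∑_{k=2}^{n} c_{k+1} S(n+1,k) + c_2·S(n+1,1) = c_{n+1} with c_2 = 1). -/

import Mathlib

/-- Stirling numbers of the second kind: `stirling2 j d` is the number of
partitions of a `j`-element set into `d` nonempty blocks. -/
def stirling2 : Nat → Nat → Nat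
  | 0, 0 => 1
  | 0, _ + 1 => 0
  | _ + 1, 0 => 0
  | n + 1, k + 1 => stirling2 n k + (k + 1) * stirling2 n (k + 1)

/-- The identity ℕ×ℕ (upper triangular) matrix. -/
def trOne {K : Type*} [CommRing K] : ℕ → ℕ → K := fun i j => if i = j then 1 else 0

/-- Product of ℕ×ℕ upper triangular matrices (entrywise a finite sum). -/
def trMul {K : Type*} [CommRing K] (M N : ℕ → ℕ → K) : ℕ → ℕ → K :=
  fun i j => ∑ k ∈ Finset.Icc i j, M i k * N k j

/-- Powers of an ℕ×ℕ upper triangular matrix. -/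
def trPow {K : Type*} [CommRing K] (M : ℕ → ℕ → K) : ℕ → (ℕ → ℕ → K)
  | 0 => trOne
  | n + 1 => trMul (trPow M n) M

/-- The `n`-diagonal matrix determined by the sequence `a`:
entry `(i, i+n)` is `a i`, all other entries vanish. -/
def diagM {K : Type*} [CommRing K] (n : ℕ) (a : ℕ → K) : ℕ → ℕ → K :=
  fun i j => if j = i + n then a i else 0

/-- A matrix is strictly upper triangular if `M i j = 0` whenever `j ≤ i`. -/
def StrictTri {K : Type*} [CommRing K] (M : ℕ → ℕ → K) : Prop :=
  ∀ i j, j ≤ i → M i j = 0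

/-- Matrix exponential `exp M = ∑ Mⁿ/n!`, entrywise a finite sum for
strictly upper triangular `M` (terms with `n > j - i` vanish). -/
noncomputable def trExp {K : Type*} [CommRing K] [Algebra ℚ K] (M : ℕ → ℕ → K) :
    ℕ → ℕ → K :=
  fun i j => ∑ n ∈ Finset.range (j - i + 1), ((n.factorial : ℚ)⁻¹) • trPow M n i j

/-- Matrix logarithm `log M = ∑_{n≥1} (-1)^{n+1} (M-1)ⁿ/n`, entrywise a finite
sum for unitriangular `M` (terms with `n > j - i` vanish). -/
noncomputable def trLog {K : Type*} [CommRing K] [Algebra ℚ K] (M : ℕ → ℕ → K) :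
    ℕ → ℕ → K :=
  fun i j => ∑ n ∈ Finset.Icc 1 (j - i),
    (((-1 : ℚ) ^ (n + 1)) / n) • trPow (fun a b => M a b - trOne a b) n i j

/-- The Stirling matrix `S` with `S_{ij} = S(j, i)`. -/
noncomputable def Smat : ℕ → ℕ → ℚ := fun i j => (stirling2 j i : ℚ)

namespace LogStirling

open PowerSeries

theorem stirling2_eq (n k : ℕ) : stirling2 n k = Nat.stirlingSecond n k := by
  induction n generalizing k with
  | zero => cases k <;> simp [stirling2, Nat.stirlingSecond]
  | succ n ih =>
    cases k with
    | zero => simp [stirling2, Nat.stirlingSecond]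
    | succ k => rw [stirling2, Nat.stirlingSecond, ih, ih, add_comm]

/-- `f = e^z - 1`. -/
noncomputable def f : PowerSeries ℚ := exp ℚ - 1

theorem f_const : constantCoeff f = 0 := by simp [f]

theorem f_subst : HasSubst f := HasSubst.of_constantCoeff_zero' f_const

theorem f_deriv : derivative ℚ f = 1 + f := by
  simp [f, derivative_exp, derivative_one]

theorem coeff_f_pow (n k : ℕ) :
    coeff n (f ^ k) = (k.factorial : ℚ) / n.factorial * stirling2 n k := by
  induction n generalizing k with
  | zero =>
    cases k with
    | zero => simp [stirling2]
    | succ k => simp [stirling2, f_const]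
  | succ n ih =>
    cases k with
    | zero => simp [stirling2, coeff_one]
    | succ k =>
      have h := coeff_derivative (f ^ (k + 1)) n
      rw [derivative_pow, f_deriv] at h
      have h2 : ((k + 1 : ℕ) : PowerSeries ℚ) * f ^ (k + 1 - 1) * (1 + f)
          = ((k + 1 : ℕ) : ℚ) • (f ^ k + f ^ (k + 1)) := by
        rw [Nat.cast_smul_eq_nsmul, nsmul_eq_mul]
        simp only [Nat.add_sub_cancel]
        ring
      rw [h2, map_smul, map_add, ih, ih] at h
      have hn : ((n : ℚ) + 1) ≠ 0 := by positivity
      rw [eq_comm, ← eq_div_iff hn] at h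
      rw [h, stirling2, Nat.factorial_succ, Nat.factorial_succ]
      push_cast
      simp only [smul_eq_mul]
      field_simp

theorem coeff_subst_f (A : PowerSeries ℚ) (n : ℕ) :
    coeff n (A.subst f) = ∑ k ∈ Finset.range (n + 1), coeff k A * coeff n (f ^ k) := by
  rw [coeff_subst' f_subst, finsum_eq_sum_of_support_subset]
  · rfl
  · intro k hk
    simp only [Finset.coe_range, Set.mem_Iio]
    by_contra hlt
    apply hk
    have : stirling2 n k = 0 := by
      rw [stirling2_eq]; exact Nat.stirlingSecond_eq_zero_of_lt (by omega)
    simp [coeff_f_pow, this]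

/-- The iterates of `f`. -/
noncomputable def F : ℕ → PowerSeries ℚ
  | 0 => X
  | t + 1 => (F t).subst f

theorem deriv_subst_f (A : PowerSeries ℚ) :
    derivative ℚ (A.subst f) = (derivative ℚ A).subst f * (1 + f) := by
  rw [derivative_subst f_subst, f_deriv]

theorem F_one : F 1 = f := by
  simp only [F]; exact subst_X f_subst

theorem one_subst_f : (1 : PowerSeries ℚ).subst f = (1 : PowerSeries ℚ) := by
  rw [← coe_substAlgHom f_subst, map_one]

theorem F_deriv (t : ℕ) :
    derivative ℚ (F (t + 1)) = (1 + F (t + 1)) * derivative ℚ (F t) := by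
  induction t with
  | zero =>
    rw [zero_add, F_one, f_deriv]
    simp [F]
  | succ t ih =>
    have h1 : derivative ℚ (F (t + 1 + 1)) = (derivative ℚ (F (t + 1))).subst f * (1 + f) :=
      deriv_subst_f _
    have h2 : derivative ℚ (F (t + 1)) = (derivative ℚ (F t)).subst f * (1 + f) :=
      deriv_subst_f _
    have h3 : F (t + 1 + 1) = (F (t + 1)).subst f := rfl
    rw [h1, ih, subst_mul f_subst, subst_add f_subst, one_subst_f, ← h3, mul_assoc,
      ← h2, ← ih]

/-- `g` is polynomial in `t` with derivative `c` at zero. -/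
def Der (g : ℕ → ℚ) (c : ℚ) : Prop :=
  ∃ P : Polynomial ℚ, (∀ t : ℕ, P.eval (t : ℚ) = g t) ∧ P.derivative.eval 0 = c

theorem Der.unique {g : ℕ → ℚ} {c d : ℚ} (h1 : Der g c) (h2 : Der g d) : c = d := by
  obtain ⟨P, hP, rfl⟩ := h1
  obtain ⟨Q, hQ, rfl⟩ := h2
  have : P = Q := by
    apply Polynomial.eq_of_infinite_eval_eq
    apply (Set.infinite_range_of_injective (Nat.cast_injective (R := ℚ))).mono
    rintro _ ⟨t, rfl⟩
    simp [hP, hQ]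
  rw [this]

theorem Der.add {g h : ℕ → ℚ} {c d : ℚ} (h1 : Der g c) (h2 : Der h d) :
    Der (fun t => g t + h t) (c + d) := by
  obtain ⟨P, hP, rfl⟩ := h1
  obtain ⟨Q, hQ, rfl⟩ := h2
  exact ⟨P + Q, by simp [hP, hQ], by simp⟩

theorem Der.mul {g h : ℕ → ℚ} {c d : ℚ} (h1 : Der g c) (h2 : Der h d) :
    Der (fun t => g t * h t) (c * h 0 + g 0 * d) := by
  obtain ⟨P, hP, rfl⟩ := h1
  obtain ⟨Q, hQ, rfl⟩ := h2
  refine ⟨P * Q, by simp [hP, hQ], ?_⟩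
  rw [← hP 0, ← hQ 0]
  simp

theorem Der.const (a : ℚ) : Der (fun _ => a) 0 := ⟨Polynomial.C a, by simp, by simp⟩

theorem Der.mul_const {g : ℕ → ℚ} {c : ℚ} (h1 : Der g c) (a : ℚ) :
    Der (fun t => g t * a) (c * a) := by
  simpa using h1.mul (Der.const a)

theorem Der.sum {ι : Type*} (s : Finset ι) {g : ι → ℕ → ℚ} {c : ι → ℚ}
    (h : ∀ i ∈ s, Der (g i) (c i)) : Der (fun t => ∑ i ∈ s, g i t) (∑ i ∈ s, c i) := by
  classical
  induction s using Finset.induction_on with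
  | empty => simpa using Der.const 0
  | insert a s ha ih =>
    simp only [Finset.sum_insert ha]
    exact (h a (by simp)).add (ih fun i hi => h i (by simp [hi]))

theorem Der.choose (m : ℕ) :
    Der (fun t => (t.choose m : ℚ)) (if m = 0 then 0 else (-1) ^ (m + 1) / m) := by
  refine ⟨Polynomial.C ((m.factorial : ℚ)⁻¹) * descPochhammer ℚ m, ?_, ?_⟩
  · intro t
    have hm : (m.factorial : ℚ) ≠ 0 := by positivity
    rw [Polynomial.eval_mul, Polynomial.eval_C, descPochhammer_eval_eq_descFactorial,
      Nat.descFactorial_eq_factorial_mul_choose]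
    push_cast
    field_simp
  · cases m with
    | zero => simp
    | succ m =>
      have key : ∀ m : ℕ, (descPochhammer ℚ m).eval (-1) = (-1) ^ m * (m.factorial : ℚ) := by
        intro m
        induction m with
        | zero => simp
        | succ m ih =>
          rw [descPochhammer_succ_eval, ih, Nat.factorial_succ]
          push_cast
          ring
      rw [descPochhammer_succ_left]
      simp only [Polynomial.derivative_mul, Polynomial.derivative_C, Polynomial.derivative_X,
        Polynomial.eval_add, Polynomial.eval_mul, Polynomial.eval_C, Polynomial.eval_X,
        Polynomial.eval_comp, Polynomial.eval_sub, Polynomial.eval_one, Polynomial.eval_zero]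
      simp only [zero_sub, key, Nat.factorial_succ]
      have hm : (m.factorial : ℚ) ≠ 0 := by positivity
      have hm' : (m : ℚ) + 1 ≠ 0 := by positivity
      push_cast
      simp
      field_simp
      ring

/-- Coefficientwise version of `Der`. -/
def DerPS (A : ℕ → PowerSeries ℚ) (H : PowerSeries ℚ) : Prop :=
  ∀ n, Der (fun t => coeff n (A t)) (coeff n H)

theorem DerPS.unique {A : ℕ → PowerSeries ℚ} {H K : PowerSeries ℚ} (h1 : DerPS A H)
    (h2 : DerPS A K) : H = K := by
  ext n
  exact (h1 n).unique (h2 n)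

theorem DerPS.mul {A B : ℕ → PowerSeries ℚ} {H K : PowerSeries ℚ} (h1 : DerPS A H)
    (h2 : DerPS B K) : DerPS (fun t => A t * B t) (H * B 0 + A 0 * K) := by
  intro n
  simp only [map_add, coeff_mul, ← Finset.sum_add_distrib]
  exact Der.sum _ fun p _ => (h1 p.1).mul (h2 p.2)

theorem DerPS.one_add {A : ℕ → PowerSeries ℚ} {H : PowerSeries ℚ} (h1 : DerPS A H) :
    DerPS (fun t => 1 + A t) H := by
  intro n
  simp only [map_add]
  simpa using (Der.const (coeff n (1 : PowerSeries ℚ))).add (h1 n)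

theorem DerPS.deriv {A : ℕ → PowerSeries ℚ} {H : PowerSeries ℚ} (h1 : DerPS A H) :
    DerPS (fun t => derivative ℚ (A t)) (derivative ℚ H) := by
  intro n
  simp only [coeff_derivative]
  exact (h1 (n + 1)).mul_const _

theorem DerPS.subst {A : ℕ → PowerSeries ℚ} {H : PowerSeries ℚ} (h1 : DerPS A H) :
    DerPS (fun t => (A t).subst f) (H.subst f) := by
  intro n
  simp only [coeff_subst_f]
  exact Der.sum _ fun k _ => (h1 k).mul_const _

/-- If `H` is the derivative at zero of the iterates, then Julia's equation (differentiated). -/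
theorem julia {H : PowerSeries ℚ} (hH : DerPS F H) (h0 : constantCoeff H = 0) :
    (derivative ℚ H).subst f = H + derivative ℚ H := by
  have e : derivative ℚ (H.subst f) = H.subst f + (1 + f) * derivative ℚ H := by
    have a1 : DerPS (fun t => derivative ℚ (F (t + 1))) (derivative ℚ (H.subst f)) :=
      hH.subst.deriv
    have a2 : DerPS (fun t => F (t + 1)) (H.subst f) := hH.subst
    have a3 := a2.one_add.mul hH.deriv
    simp only [← F_deriv] at a3
    have := a1.unique a3
    rw [this, zero_add, F_one]
    simp [F]
  have w : H.subst f - (1 + f) * H = 0 := by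
    have hd : derivative ℚ (H.subst f - (1 + f) * H) = H.subst f - (1 + f) * H := by
      rw [map_sub, e, Derivation.leibniz, map_add, derivative_one, f_deriv]
      simp only [smul_eq_mul]
      ring
    have hc : coeff 0 (H.subst f - (1 + f) * H) = 0 := by
      rw [map_sub, coeff_subst_f]
      simp [h0]
    ext n
    induction n with
    | zero => simpa using hc
    | succ n ih =>
      have := coeff_derivative (H.subst f - (1 + f) * H) n
      rw [hd, ih] at this
      have hn : ((n : ℚ) + 1) ≠ 0 := by positivity
      simpa [hn] using this.symm
  have e2 := deriv_subst_f H
  rw [e, sub_eq_zero.mp w] at e2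
  have hne : (1 + f) ≠ 0 := by
    intro h
    have := congrArg constantCoeff h
    simp [f_const] at this
  apply mul_right_cancel₀ hne
  rw [← e2]
  ring

/-- First row of the powers of `S - 1`. -/
noncomputable def w (m n : ℕ) : ℚ := trPow (fun a b => Smat a b - trOne a b) m 1 n

theorem w_zero_right (m : ℕ) : w m 0 = 0 := by
  cases m <;> simp [w, trPow, trOne, trMul]

theorem w_zero (n : ℕ) : w 0 n = if 1 = n then 1 else 0 := rfl

theorem w_succ (m n : ℕ) :
    w (m + 1) n + w m n = ∑ k ∈ Finset.range (n + 1), w m k * (stirling2 n k : ℚ) := by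
  have h1 : w (m + 1) n = ∑ k ∈ Finset.Icc 1 n, w m k * (Smat k n - trOne k n) := rfl
  have h2 : ∑ k ∈ Finset.Icc 1 n, w m k * (Smat k n - trOne k n)
      = ∑ k ∈ Finset.range (n + 1), w m k * (Smat k n - trOne k n) := by
    apply Finset.sum_subset
    · intro k; simp
    · intro k hk hk'
      have : k = 0 := by simp at hk hk'; omega
      rw [this, w_zero_right, zero_mul]
  rw [h1, h2]
  simp only [mul_sub, Finset.sum_sub_distrib, trOne, Smat]
  simp

theorem w_eq_zero (m n : ℕ) (h : n ≤ m) : w m n = 0 := by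
  induction m generalizing n with
  | zero => rw [Nat.le_zero.mp h, w_zero_right]
  | succ m ih =>
    have h1 := w_succ m n
    have hs : (stirling2 n n : ℚ) = 1 := by rw [stirling2_eq, Nat.stirlingSecond_self]; simp
    rw [Finset.sum_range_succ, hs, mul_one, Finset.sum_eq_zero] at h1
    · linarith
    · intro k hk
      rw [ih k (by simp at hk; omega), zero_mul]

theorem coeff_F (t K n : ℕ) (h : n ≤ K) :
    (n.factorial : ℚ) * coeff n (F t) = ∑ m ∈ Finset.range K, (t.choose m : ℚ) * w m n := by
  induction t generalizing n with
  | zero =>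
    cases K with
    | zero =>
      have : n = 0 := by omega
      subst this
      simp [F]
    | succ K =>
      rw [Finset.sum_range_succ']
      simp only [F, coeff_X, w_zero]
      by_cases hn : n = 1
      · subst hn; simp
      · simp [hn, Ne.symm hn]
  | succ t ih =>
    have h1 : (n.factorial : ℚ) * coeff n (F (t + 1))
        = ∑ k ∈ Finset.range (n + 1), ((k.factorial : ℚ) * coeff k (F t)) * stirling2 n k := by
      have hn : (n.factorial : ℚ) ≠ 0 := by positivity
      rw [F, coeff_subst_f, Finset.mul_sum]
      refine Finset.sum_congr rfl fun k _ => ?_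
      rw [coeff_f_pow]
      field_simp
    have h2 : ∑ k ∈ Finset.range (n + 1), ((k.factorial : ℚ) * coeff k (F t)) * stirling2 n k
        = ∑ m ∈ Finset.range K, (t.choose m : ℚ) * (w (m + 1) n + w m n) := by
      simp only [w_succ, Finset.mul_sum]
      rw [Finset.sum_comm]
      refine Finset.sum_congr rfl fun k hk => ?_
      rw [ih k (by simp at hk; omega), Finset.sum_mul]
      exact Finset.sum_congr rfl fun m _ => by ring
    rw [h1, h2]
    have h3 : ∑ m ∈ Finset.range K, ((t + 1).choose m : ℚ) * w m n
        = ∑ m ∈ Finset.range (K + 1), ((t + 1).choose m : ℚ) * w m n := by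
      rw [Finset.sum_range_succ _ K, w_eq_zero K n h]; simp
    have h4 : ∑ m ∈ Finset.range K, (t.choose m : ℚ) * w m n
        = ∑ m ∈ Finset.range (K + 1), (t.choose m : ℚ) * w m n := by
      rw [Finset.sum_range_succ _ K, w_eq_zero K n h]; simp
    simp only [mul_add, Finset.sum_add_distrib]
    rw [h3, h4, Finset.sum_range_succ', Finset.sum_range_succ']
    simp only [Nat.choose_succ_succ, Nat.cast_add, add_mul, Finset.sum_add_distrib]
    simp
    ring

/-- The iterative logarithm. -/
noncomputable def H : PowerSeries ℚ := PowerSeries.mk fun n => trLog Smat 1 n / n.factorial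

theorem log_eq (n : ℕ) : trLog Smat 1 n
    = ∑ m ∈ Finset.range n, (if m = 0 then 0 else (-1 : ℚ) ^ (m + 1) / m) * w m n := by
  have h : trLog Smat 1 n = ∑ m ∈ Finset.Icc 1 (n - 1), ((-1 : ℚ) ^ (m + 1) / m) * w m n := rfl
  rw [h]
  have h2 : ∑ m ∈ Finset.Icc 1 (n - 1), ((-1 : ℚ) ^ (m + 1) / m) * w m n
      = ∑ m ∈ Finset.Icc 1 (n - 1), (if m = 0 then 0 else (-1 : ℚ) ^ (m + 1) / m) * w m n := by
    refine Finset.sum_congr rfl fun m hm => ?_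
    rw [if_neg (by simp at hm; omega)]
  rw [h2]
  apply Finset.sum_subset
  · intro m hm
    simp at hm ⊢
    omega
  · intro m hm hm'
    have : m = 0 := by simp at hm hm'; omega
    simp [this]

theorem H_der : DerPS F H := by
  intro n
  have hn : (n.factorial : ℚ) ≠ 0 := by positivity
  have h1 : (fun t => coeff n (F t)) =
      fun t => (∑ m ∈ Finset.range n, (t.choose m : ℚ) * w m n) * (n.factorial : ℚ)⁻¹ := by
    funext t
    rw [← coeff_F t n n le_rfl]
    field_simp
  rw [h1, H, coeff_mk, log_eq, div_eq_mul_inv]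
  exact (Der.sum _ fun m _ => (Der.choose m).mul_const _).mul_const _

end LogStirling

theorem log_stirling_recurrence (n : ℕ) (hn : 1 ≤ n) :
    trLog Smat 1 (n + 1)
      = ∑ k ∈ Finset.Icc 1 n, trLog Smat 1 (k + 1) * (stirling2 (n + 1) k : ℚ) := by
  have h0 : PowerSeries.constantCoeff LogStirling.H = 0 := by
    simp [LogStirling.H, trLog]
  have hj := congrArg (PowerSeries.coeff (n + 1)) (LogStirling.julia LogStirling.H_der h0)
  have hf : ((n + 1).factorial : ℚ) ≠ 0 := by positivity
  have hd : ∀ k, PowerSeries.coeff k (PowerSeries.derivative ℚ LogStirling.H)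
      = trLog Smat 1 (k + 1) / k.factorial := by
    intro k
    have hk : (k.factorial : ℚ) ≠ 0 := by positivity
    rw [PowerSeries.coeff_derivative, LogStirling.H, PowerSeries.coeff_mk, Nat.factorial_succ]
    push_cast
    field_simp
  have hs : ∑ k ∈ Finset.range (n + 1 + 1),
      PowerSeries.coeff k (PowerSeries.derivative ℚ LogStirling.H)
        * PowerSeries.coeff (n + 1) (LogStirling.f ^ k)
      = (∑ k ∈ Finset.range (n + 1 + 1), trLog Smat 1 (k + 1) * (stirling2 (n + 1) k : ℚ))
        / ((n + 1).factorial : ℚ) := by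
    rw [Finset.sum_div]
    refine Finset.sum_congr rfl fun k _ => ?_
    have hk : (k.factorial : ℚ) ≠ 0 := by positivity
    rw [hd, LogStirling.coeff_f_pow]
    field_simp
  rw [LogStirling.coeff_subst_f, hs, map_add, hd, LogStirling.H, PowerSeries.coeff_mk,
    ← add_div, div_left_inj' hf, Finset.sum_range_succ] at hj
  have hself : (stirling2 (n + 1) (n + 1) : ℚ) = 1 := by
    rw [LogStirling.stirling2_eq, Nat.stirlingSecond_self]; simp
  rw [hself, mul_one, add_left_inj] at hj
  rw [← hj, eq_comm]
  apply Finset.sum_subset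
  · intro k hk
    simp at hk ⊢
    omega
  · intro k hk hk'
    have : k = 0 := by simp at hk hk'; omega
    simp [this, stirling2]
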